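/- Let ν ∈ ℝ, let û, U : ℝ × ℝ → ℝ be twice continuously differentiable, let a, u_d : ℝ × ℝ → ℝ be continuous, and let r : ℝ → ℝ be continuously differentiable. Suppose that for all t ≥ 0 and x ∈ [0,1], U satisfies the regulator equation ∂ₜU = ν·∂ₓₓU − U·∂ₓU + a·(û + U) − (û·∂ₓU + U·∂ₓû) + u_d, and that ∫₀¹ U(t,x) dx = r(t) for all t ≥ 0. Then for every t ≥ 0 the Neumann trace at x = 1 is determined by the formula ν·∂ₓU(t,1) = ν·∂ₓU(t,0) + (1/2)·(U(t,1)² − U(t,0)²) + û(t,1)·U(t,1) − û(t,0)·U(t,0) + r'(t) − ∫₀¹ [a(t,x)·(û(t,x) + U(t,x)) + u_d(t,x)] dx. -/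

import Mathlib

/-- Partial derivative in the first (time) variable. -/
noncomputable def pt (w : ℝ × ℝ → ℝ) (t x : ℝ) : ℝ := deriv (fun s => w (s, x)) t

/-- First partial derivative in the second (space) variable. -/
noncomputable def px (w : ℝ × ℝ → ℝ) (t x : ℝ) : ℝ := deriv (fun y => w (t, y)) x

/-- Second partial derivative in the second (space) variable. -/
noncomputable def pxx (w : ℝ × ℝ → ℝ) (t x : ℝ) : ℝ := deriv (fun y => px w t y) x

open Set MeasureTheory Filter Topology

theorem hasDerivAt_fst_slice {w : ℝ × ℝ → ℝ} (hw : Differentiable ℝ w) (t x : ℝ) :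
    HasDerivAt (fun s => w (s, x)) (fderiv ℝ w (t, x) (1, 0)) t :=
  (hw (t, x)).hasFDerivAt.comp_hasDerivAt t ((hasDerivAt_id t).prodMk (hasDerivAt_const t x))

theorem hasDerivAt_snd_slice {w : ℝ × ℝ → ℝ} (hw : Differentiable ℝ w) (t x : ℝ) :
    HasDerivAt (fun y => w (t, y)) (fderiv ℝ w (t, x) (0, 1)) x :=
  (hw (t, x)).hasFDerivAt.comp_hasDerivAt x ((hasDerivAt_const x t).prodMk (hasDerivAt_id x))

theorem pt_eq_fderiv {w : ℝ × ℝ → ℝ} (hw : Differentiable ℝ w) (t x : ℝ) :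
    pt w t x = fderiv ℝ w (t, x) (1, 0) :=
  (hasDerivAt_fst_slice hw t x).deriv

theorem px_eq_fderiv {w : ℝ × ℝ → ℝ} (hw : Differentiable ℝ w) (t x : ℝ) :
    px w t x = fderiv ℝ w (t, x) (0, 1) :=
  (hasDerivAt_snd_slice hw t x).deriv

theorem hasDerivAt_px {w : ℝ × ℝ → ℝ} (hw : Differentiable ℝ w) (t x : ℝ) :
    HasDerivAt (fun y => w (t, y)) (px w t x) x :=
  (hasDerivAt_snd_slice hw t x).differentiableAt.hasDerivAt

theorem continuous_pt {w : ℝ × ℝ → ℝ} (hw : ContDiff ℝ 1 w) :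
    Continuous fun p : ℝ × ℝ => pt w p.1 p.2 := by
  simp only [pt_eq_fderiv (hw.differentiable one_ne_zero)]
  exact (hw.continuous_fderiv one_ne_zero).clm_apply continuous_const

theorem contDiff_px {w : ℝ × ℝ → ℝ} (hw : ContDiff ℝ 2 w) :
    ContDiff ℝ 1 fun p : ℝ × ℝ => px w p.1 p.2 := by
  simp only [px_eq_fderiv (hw.differentiable two_ne_zero)]
  exact (hw.fderiv_right (m := 1) (by norm_num)).clm_apply contDiff_const

theorem hasDerivAt_pxx {w : ℝ × ℝ → ℝ} (hw : ContDiff ℝ 2 w) (t x : ℝ) :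
    HasDerivAt (fun y => px w t y) (pxx w t x) x :=
  hasDerivAt_px ((contDiff_px hw).differentiable one_ne_zero) t x

theorem continuous_pxx {w : ℝ × ℝ → ℝ} (hw : ContDiff ℝ 2 w) (t : ℝ) :
    Continuous fun x => pxx w t x := by
  have h : ContDiff ℝ 1 fun y => px w t y := (contDiff_px hw).comp (contDiff_prodMk_right t)
  exact h.continuous_deriv le_rfl

/-- Differentiation under the integral sign over a compact interval. -/
theorem hasDerivAt_integral_slice {w : ℝ × ℝ → ℝ} (hw : ContDiff ℝ 1 w) (a b t : ℝ) :
    HasDerivAt (fun s => ∫ x in a..b, w (s, x)) (∫ x in a..b, pt w t x) t := by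
  have hpt := continuous_pt hw
  obtain ⟨C, hC⟩ := ((isCompact_closedBall t 1).prod (isCompact_uIcc (a := a) (b := b)))
    |>.exists_bound_of_continuousOn hpt.continuousOn
  refine (intervalIntegral.hasDerivAt_integral_of_dominated_loc_of_deriv_le
    (F := fun s x => w (s, x)) (F' := fun s x => pt w s x) (bound := fun _ => C)
    (Metric.ball_mem_nhds t one_pos) ?_ ?_ ?_ ?_ ?_ ?_).2
  · exact Eventually.of_forall fun s =>
      (hw.continuous.comp (Continuous.prodMk_right s)).aestronglyMeasurable
  · exact (hw.continuous.comp (Continuous.prodMk_right t)).intervalIntegrable a b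
  · exact (hpt.comp (Continuous.prodMk_right t)).aestronglyMeasurable
  · exact Eventually.of_forall fun x hx s hs =>
      hC (s, x) ⟨Metric.ball_subset_closedBall hs, uIoc_subset_uIcc hx⟩
  · exact intervalIntegrable_const
  · exact Eventually.of_forall fun x _ s _ =>
      (hasDerivAt_fst_slice (hw.differentiable one_ne_zero) s x).differentiableAt.hasDerivAt

/-- the feedforward controller formula F₁ from the Discussion
section, obtained by integrating the regulator equation over [0,1] and using
the constraint `∫₀¹ U(t,x) dx = r(t)`. -/
theorem stmt_15 (ν : ℝ) (uh U a ud : ℝ × ℝ → ℝ) (r : ℝ → ℝ)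
    (huh : ContDiff ℝ 2 uh) (hU : ContDiff ℝ 2 U)
    (ha : Continuous a) (hud : Continuous ud) (hr : ContDiff ℝ 1 r)
    (heq : ∀ t ≥ (0:ℝ), ∀ x ∈ Set.Icc (0:ℝ) 1,
      pt U t x = ν * pxx U t x - U (t, x) * px U t x
        + a (t, x) * (uh (t, x) + U (t, x))
        - (uh (t, x) * px U t x + U (t, x) * px uh t x) + ud (t, x))
    (hcon : ∀ t ≥ (0:ℝ), (∫ x in (0:ℝ)..1, U (t, x)) = r t) :
    ∀ t ≥ (0:ℝ),
      ν * px U t 1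
        = ν * px U t 0 + (1/2) * ((U (t, 1)) ^ 2 - (U (t, 0)) ^ 2)
          + uh (t, 1) * U (t, 1) - uh (t, 0) * U (t, 0) + deriv r t
          - ∫ x in (0:ℝ)..1,
              (a (t, x) * (uh (t, x) + U (t, x)) + ud (t, x)) := by
  intro t ht
  have dU := hU.differentiable two_ne_zero
  have duh := huh.differentiable two_ne_zero
  have cU : Continuous fun x => U (t, x) := hU.continuous.comp (Continuous.prodMk_right t)
  have cuh : Continuous fun x => uh (t, x) := huh.continuous.comp (Continuous.prodMk_right t)
  have ca : Continuous fun x => a (t, x) := ha.comp (Continuous.prodMk_right t)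
  have cud : Continuous fun x => ud (t, x) := hud.comp (Continuous.prodMk_right t)
  have cpU : Continuous fun x => px U t x :=
    (contDiff_px hU).continuous.comp (Continuous.prodMk_right t)
  have cpuh : Continuous fun x => px uh t x :=
    (contDiff_px huh).continuous.comp (Continuous.prodMk_right t)
  have cpxx := continuous_pxx hU t
  have hr' : ∫ x in (0:ℝ)..1, pt U t x = deriv r t := by
    have h₁ := (hasDerivAt_integral_slice (hU.of_le one_le_two) 0 1 t).hasDerivWithinAt
      (s := Ici 0)
    have h₂ := (hr.differentiable one_ne_zero t).hasDerivAt.hasDerivWithinAt (s := Ici 0)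
    exact (uniqueDiffOn_Ici (0:ℝ) t ht).eq_deriv _ h₁
      (h₂.congr (fun s hs => hcon s hs) (hcon t ht))
  have hflux : ∫ x in (0:ℝ)..1, (ν * pxx U t x - U (t, x) * px U t x
        - (uh (t, x) * px U t x + U (t, x) * px uh t x))
      = (ν * px U t 1 - (1/2) * U (t, 1) ^ 2 - uh (t, 1) * U (t, 1))
        - (ν * px U t 0 - (1/2) * U (t, 0) ^ 2 - uh (t, 0) * U (t, 0)) := by
    refine intervalIntegral.integral_eq_sub_of_hasDerivAt
      (f := fun x => ν * px U t x - (1/2) * U (t, x) ^ 2 - uh (t, x) * U (t, x))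
      (fun x _ => ?_) (Continuous.intervalIntegrable (by fun_prop) 0 1)
    refine ((((hasDerivAt_pxx hU t x).const_mul ν).sub
      (((hasDerivAt_px dU t x).pow 2).const_mul (1/2))).sub
      ((hasDerivAt_px duh t x).mul (hasDerivAt_px dU t x))).congr_deriv ?_
    push_cast
    ring
  have hsum : ∫ x in (0:ℝ)..1, pt U t x
      = (∫ x in (0:ℝ)..1, (ν * pxx U t x - U (t, x) * px U t x
          - (uh (t, x) * px U t x + U (t, x) * px uh t x)))
        + ∫ x in (0:ℝ)..1, (a (t, x) * (uh (t, x) + U (t, x)) + ud (t, x)) := by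
    rw [← intervalIntegral.integral_add (Continuous.intervalIntegrable (by fun_prop) 0 1)
      (Continuous.intervalIntegrable (by fun_prop) 0 1)]
    refine intervalIntegral.integral_congr fun x hx => ?_
    rw [uIcc_of_le zero_le_one] at hx
    simp only [heq t ht x hx]
    ring
  linarith
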